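/- Let G be a connected finite simple graph that is bull-free and diamond-free with ω = ω(G) > 2, let K be a maximum clique of G, and suppose G is not isomorphic to a subgraph of K_ω □ K_2 (i.e., there is no injective graph homomorphism from G into K_ω □ K_2). Let i ≥ 2, let G' be a connected component of the subgraph of G induced by N_i(K) that contains a triangle, and let k be a positive integer. If the subgraph of G induced by K ∪ N_1(K) ∪ ⋯ ∪ N_{i−1}(K) is k-colorable, then the subgraph of G induced by K ∪ N_1(K) ∪ ⋯ ∪ N_{i−1}(K) ∪ V(G') is k-colorable. -/

import Mathlib

open SimpleGraph

/-- `G` is `H`-free: no induced subgraph of `G` is isomorphic to `H`. -/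
def IsIndFree {V W : Type*} (G : SimpleGraph V) (H : SimpleGraph W) : Prop :=
  ∀ s : Set V, ¬ Nonempty (H ≃g G.induce s)

/-- The bull: a triangle with two pendant edges at distinct vertices. -/
def bull : SimpleGraph (Fin 5) :=
  SimpleGraph.fromEdgeSet {s(0,1), s(1,2), s(0,2), s(1,3), s(2,4)}

/-- The diamond: `K₄` minus an edge. -/
def diamond : SimpleGraph (Fin 4) :=
  SimpleGraph.fromEdgeSet {s(0,2), s(0,3), s(1,2), s(1,3), s(2,3)}

/-- Distance from a vertex `x` to a set `K` of vertices. -/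
noncomputable def distToSet {V : Type*} (G : SimpleGraph V) (x : V) (K : Set V) : ℕ :=
  sInf ((G.dist x) '' K)

/-- `N_i(K)`: the set of vertices at distance exactly `i` from `K`. -/
def levelSet {V : Type*} (G : SimpleGraph V) (K : Set V) (i : ℕ) : Set V :=
  {x | distToSet G x K = i}

theorem IsIndFree.not_embedding {V W : Type*} {G : SimpleGraph V} {H : SimpleGraph W}
    (h : IsIndFree G H) (f : H ↪g G) : False :=
  h _ ⟨f.isoInduceRange⟩

/-- In a diamond-free graph, distinct common neighbours of the ends of an edge are adjacent. -/
theorem IsIndFree.adj_of_diamond {V : Type*} {G : SimpleGraph V} (h : IsIndFree G diamond)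
    {a b c d : V} (hab : a ≠ b) (hac : G.Adj a c) (had : G.Adj a d) (hbc : G.Adj b c)
    (hbd : G.Adj b d) (hcd : G.Adj c d) : G.Adj a b := by
  by_contra hn
  have hn' : ¬ G.Adj b a := fun h => hn h.symm
  refine h.not_embedding ⟨⟨![a, b, c, d], ?_⟩, ?_⟩
  · intro i j hij
    fin_cases i <;> fin_cases j <;>
      simp_all [hac.ne, had.ne, hbc.ne, hbd.ne, hcd.ne, hac.ne', had.ne', hbc.ne', hbd.ne',
        hcd.ne']
  · intro i j
    change G.Adj (![a, b, c, d] i) (![a, b, c, d] j) ↔ _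
    fin_cases i <;> fin_cases j <;>
      simp [diamond, hn, hn', hac, had, hbc, hbd, hcd, hac.symm, had.symm, hbc.symm, hbd.symm,
        hcd.symm]

/-- In a bull-free graph, private neighbours of two vertices of a triangle are adjacent. -/
theorem IsIndFree.adj_of_bull {V : Type*} {G : SimpleGraph V} (h : IsIndFree G bull)
    {a b c x y : V} (hab : G.Adj a b) (hac : G.Adj a c) (hbc : G.Adj b c)
    (hxb : G.Adj x b) (hyc : G.Adj y c) (hxa : ¬ G.Adj x a) (hxc : ¬ G.Adj x c)
    (hya : ¬ G.Adj y a) (hyb : ¬ G.Adj y b) : G.Adj x y := by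
  by_contra hn
  have hn' : ¬ G.Adj y x := fun h => hn h.symm
  have hax : ¬ G.Adj a x := fun h => hxa h.symm
  have hcx : ¬ G.Adj c x := fun h => hxc h.symm
  have hay : ¬ G.Adj a y := fun h => hya h.symm
  have hby : ¬ G.Adj b y := fun h => hyb h.symm
  have hxy : x ≠ y := by rintro rfl; exact hxc hyc
  have hxa' : x ≠ a := by rintro rfl; exact hxc hac
  have hxc' : x ≠ c := by rintro rfl; exact hxa hac.symm
  have hya' : y ≠ a := by rintro rfl; exact hyb hab
  have hyb' : y ≠ b := by rintro rfl; exact hya hab.symm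
  refine h.not_embedding ⟨⟨![a, b, c, x, y], ?_⟩, ?_⟩
  · intro i j hij
    fin_cases i <;> fin_cases j <;>
      simp_all [hab.ne, hac.ne, hbc.ne, hxb.ne, hyc.ne, hab.ne', hac.ne', hbc.ne', hxb.ne',
        hyc.ne', hxy.symm, hxa'.symm, hxc'.symm, hya'.symm, hyb'.symm]
  · intro i j
    change G.Adj (![a, b, c, x, y] i) (![a, b, c, x, y] j) ↔ _
    fin_cases i <;> fin_cases j <;>
      simp [bull, hn, hn', hab, hac, hbc, hxb, hyc, hab.symm, hac.symm, hbc.symm, hxb.symm,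
        hyc.symm, hxa, hxc, hya, hyb, hax, hcx, hay, hby]

/-- A function that is injective on `S ⊆ Q` can be changed outside `S` so as to become injective
on `Q`, provided the codomain is large enough. -/
theorem Set.InjOn.exists_injOn_extend {α β : Type*} [DecidableEq α] [Fintype β] {f : α → β}
    {S Q : Finset α} (hf : Set.InjOn f S) (hSQ : S ⊆ Q) (hQ : Q.card ≤ Fintype.card β) :
    ∃ g : α → β, Set.InjOn g Q ∧ Set.EqOn g f S := by
  classical
  suffices H : ∀ T : Finset α, (S ∪ T).card ≤ Fintype.card β →
      ∃ g : α → β, Set.InjOn g ↑(S ∪ T) ∧ Set.EqOn g f S by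
    have := H Q
    rw [Finset.union_eq_right.2 hSQ] at this
    exact this hQ
  intro T
  induction T using Finset.induction_on with
  | empty => exact fun _ => ⟨f, by simpa using hf, fun _ _ => rfl⟩
  | insert a T _ ih =>
    intro hcard
    rw [Finset.union_insert] at hcard ⊢
    by_cases ha : a ∈ S ∪ T
    · rw [Finset.insert_eq_of_mem ha] at hcard ⊢
      exact ih hcard
    · rw [Finset.card_insert_of_notMem ha] at hcard
      obtain ⟨g, hg, hgf⟩ := ih (by omega)
      obtain ⟨b, hb⟩ : ∃ b, b ∉ (S ∪ T).image g := by
        by_contra! hall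
        have h1 := Finset.card_le_card fun b (_ : b ∈ Finset.univ) => hall b
        have h2 := Finset.card_image_le (s := S ∪ T) (f := g)
        rw [Finset.card_univ] at h1
        omega
      refine ⟨Function.update g a b, ?_, ?_⟩
      · rw [Finset.coe_insert, Set.injOn_insert (by simpa using ha)]
        have heq : Set.EqOn g (Function.update g a b) ↑(S ∪ T) := fun x hx => by
          rw [Function.update_of_ne]
          rintro rfl
          exact ha hx
        refine ⟨hg.congr heq, ?_⟩
        rw [← heq.image_eq, Function.update_self]
        simpa using hb
      · intro x hx
        rw [Function.update_of_ne, hgf hx]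
        rintro rfl
        exact ha (Finset.mem_union_left _ hx)

section Cliques

variable {V : Type*} {G : SimpleGraph V}

/-- A vertex adjacent to all other vertices of a maximal clique belongs to it. -/
theorem mem_of_maximal_isClique {Q : Set V} (hQ : Maximal G.IsClique Q) {v : V}
    (hv : ∀ q ∈ Q, v ≠ q → G.Adj v q) : v ∈ Q :=
  hQ.2 (hQ.1.insert hv) (Set.subset_insert v Q) (Set.mem_insert v Q)

/-- In a diamond-free graph, a vertex outside a maximal clique has at most one neighbour in it. -/
theorem IsIndFree.eq_of_adj_maximal_clique (hGd : IsIndFree G diamond) {Q : Set V}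
    (hQ : Maximal G.IsClique Q) {v p q : V} (hv : v ∉ Q) (hp : p ∈ Q) (hq : q ∈ Q)
    (hvp : G.Adj v p) (hvq : G.Adj v q) : p = q := by
  by_contra hpq
  refine hv (mem_of_maximal_isClique hQ fun r hr hvr => ?_)
  by_cases hrp : r = p
  · exact hrp ▸ hvp
  by_cases hrq : r = q
  · exact hrq ▸ hvq
  exact hGd.adj_of_diamond hvr hvp hvq (hQ.1 hr hp hrp) (hQ.1 hr hq hrq) (hQ.1 hp hq hpq)

/-- In a bull-free and diamond-free graph, outside neighbours of distinct vertices of a maximal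
clique with at least three vertices are adjacent. -/
theorem adj_of_adj_maximal_clique (hGb : IsIndFree G bull) (hGd : IsIndFree G diamond)
    {Q : Set V} (hQ : Maximal G.IsClique Q) (hQ3 : ∀ p q, ∃ r ∈ Q, r ≠ p ∧ r ≠ q)
    {a b x y : V} (ha : a ∈ Q) (hb : b ∈ Q) (hab : a ≠ b) (hx : x ∉ Q) (hy : y ∉ Q)
    (hxa : G.Adj x a) (hyb : G.Adj y b) : G.Adj x y := by
  obtain ⟨r, hr, hra, hrb⟩ := hQ3 a b
  refine hGb.adj_of_bull (hQ.1 hr ha hra) (hQ.1 hr hb hrb) (hQ.1 ha hb hab) hxa hyb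
    (fun h => ?_) (fun h => ?_) (fun h => ?_) (fun h => ?_)
  · exact hra (hGd.eq_of_adj_maximal_clique hQ hx hr ha h hxa)
  · exact hab (hGd.eq_of_adj_maximal_clique hQ hx ha hb hxa h)
  · exact hrb (hGd.eq_of_adj_maximal_clique hQ hy hr hb h hyb)
  · exact hab (hGd.eq_of_adj_maximal_clique hQ hy ha hb h hyb)

/-- `Q` contains three distinct vertices `a`, `b`, `c` with respective neighbours `x`, `y`, `z`
outside `Q`. -/
structure ThreeAttachments (G : SimpleGraph V) (Q : Set V) (a b c x y z : V) : Prop where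
  memA : a ∈ Q
  memB : b ∈ Q
  memC : c ∈ Q
  hab : a ≠ b
  hac : a ≠ c
  hbc : b ≠ c
  hx : x ∉ Q
  hy : y ∉ Q
  hz : z ∉ Q
  hxa : G.Adj x a
  hyb : G.Adj y b
  hzc : G.Adj z c

namespace ThreeAttachments

variable {Q : Set V} {a b c x y z : V}

theorem exists_third (h : ThreeAttachments G Q a b c x y z) (p q : V) :
    ∃ r ∈ Q, r ≠ p ∧ r ≠ q := by
  have := h.memA; have := h.memB; have := h.memC
  have := h.hab; have := h.hac; have := h.hbc
  by_cases ha : a = p ∨ a = q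
  · by_cases hb : b = p ∨ b = q
    · exact ⟨c, by grind⟩
    · exact ⟨b, by grind⟩
  · exact ⟨a, by grind⟩

theorem adj (h : ThreeAttachments G Q a b c x y z) (hGb : IsIndFree G bull)
    (hGd : IsIndFree G diamond) (hQ : Maximal G.IsClique Q) {p q v w : V} (hp : p ∈ Q)
    (hq : q ∈ Q) (hpq : p ≠ q) (hv : v ∉ Q) (hw : w ∉ Q) (hvp : G.Adj v p) (hwq : G.Adj w q) :
    G.Adj v w :=
  adj_of_adj_maximal_clique hGb hGd hQ h.exists_third hp hq hpq hv hw hvp hwq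

theorem exists_two_attachments (h : ThreeAttachments G Q a b c x y z) (p : V) :
    ∃ s ∈ Q, ∃ t ∈ Q, ∃ v ∉ Q, ∃ w ∉ Q, s ≠ p ∧ t ≠ p ∧ s ≠ t ∧ G.Adj v s ∧ G.Adj w t ∧
      (v = x ∨ v = y ∨ v = z) ∧ (w = x ∨ w = y ∨ w = z) := by
  obtain ⟨_, _, _, _, _, _, _, _, _, _, _, _⟩ := h
  by_cases ha : a = p
  · exact ⟨b, ‹_›, c, ‹_›, y, ‹_›, z, ‹_›, by grind⟩
  by_cases hb : b = p
  · exact ⟨a, ‹_›, c, ‹_›, x, ‹_›, z, ‹_›, by grind⟩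
  · exact ⟨a, ‹_›, b, ‹_›, x, ‹_›, y, ‹_›, by grind⟩

theorem eq_of_adj (h : ThreeAttachments G Q a b c x y z) (hGb : IsIndFree G bull)
    (hGd : IsIndFree G diamond) (hQ : Maximal G.IsClique Q) {p v w : V} (hp : p ∈ Q)
    (hv : v ∉ Q) (hw : w ∉ Q) (hvp : G.Adj v p) (hwp : G.Adj w p) : v = w := by
  by_contra hvw
  obtain ⟨s, hs, t, ht, s', hs', t', ht', hsp, htp, hst, hss, htt, -, -⟩ :=
    h.exists_two_attachments p
  have h1 := h.adj hGb hGd hQ hp hs hsp.symm hv hs' hvp hss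
  have h2 := h.adj hGb hGd hQ hp ht htp.symm hv ht' hvp htt
  have h3 := h.adj hGb hGd hQ hp hs hsp.symm hw hs' hwp hss
  have h4 := h.adj hGb hGd hQ hp ht htp.symm hw ht' hwp htt
  have h5 := h.adj hGb hGd hQ hs ht hst hs' ht' hss htt
  have h6 := hGd.adj_of_diamond hvw h1 h2 h3 h4 h5
  have hps' : p ≠ s' := by rintro rfl; exact hs' hp
  have h7 := hGd.adj_of_diamond hps' hvp.symm hwp.symm h1.symm h3.symm h6
  exact hsp (hGd.eq_of_adj_maximal_clique hQ hs' hs hp hss h7.symm)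

/-- Every neighbour outside `Q` of a vertex of `Q` lies in each maximal clique through `x`, `y`,
`z`. -/
theorem mem_of_adj (h : ThreeAttachments G Q a b c x y z) (hGb : IsIndFree G bull)
    (hGd : IsIndFree G diamond) (hQ : Maximal G.IsClique Q) {R : Set V}
    (hR : Maximal G.IsClique R) (hxR : x ∈ R) (hyR : y ∈ R) (hzR : z ∈ R) {p v : V}
    (hp : p ∈ Q) (hv : v ∉ Q) (hvp : G.Adj v p) : v ∈ R := by
  obtain ⟨s, hs, t, ht, s', hs', t', ht', hsp, htp, hst, hss, htt, hs'', ht''⟩ :=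
    h.exists_two_attachments p
  by_contra hvR
  have h1 := h.adj hGb hGd hQ hp hs hsp.symm hv hs' hvp hss
  have h2 := h.adj hGb hGd hQ hp ht htp.symm hv ht' hvp htt
  have h3 : s' ∈ R := by rcases hs'' with rfl | rfl | rfl <;> assumption
  have h4 : t' ∈ R := by rcases ht'' with rfl | rfl | rfl <;> assumption
  have h5 := hGd.eq_of_adj_maximal_clique hR hvR h3 h4 h1 h2
  subst h5
  exact hst (hGd.eq_of_adj_maximal_clique hQ hs' hs ht hss htt)

theorem exists_hom [Fintype V] (h : ThreeAttachments G Q a b c x y z) (hconn : G.Connected)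
    (hGb : IsIndFree G bull) (hGd : IsIndFree G diamond) (hQ : Maximal G.IsClique Q) :
    ∃ f : G →g (completeGraph (Fin G.cliqueNum) □ completeGraph (Fin 2)),
      Function.Injective f := by
  classical
  have hxy := h.adj hGb hGd hQ h.memA h.memB h.hab h.hx h.hy h.hxa h.hyb
  have hxz := h.adj hGb hGd hQ h.memA h.memC h.hac h.hx h.hz h.hxa h.hzc
  have hyz := h.adj hGb hGd hQ h.memB h.memC h.hbc h.hy h.hz h.hyb h.hzc
  obtain ⟨R, hxyzR, hR⟩ := Finite.exists_le_maximal (p := G.IsClique) (a := {x, y, z}) (by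
    intro u hu v hv huv
    simp only [Set.mem_insert_iff, Set.mem_singleton_iff] at hu hv
    rcases hu with rfl | rfl | rfl <;> rcases hv with rfl | rfl | rfl <;>
      simp_all [SimpleGraph.adj_comm])
  have hxR : x ∈ R := hxyzR (by simp)
  have hyR : y ∈ R := hxyzR (by simp)
  have hzR : z ∈ R := hxyzR (by simp)
  have hdisj : ∀ v ∈ Q, v ∉ R := by
    intro v hvQ hvR
    have hvx : v ≠ x := by rintro rfl; exact h.hx hvQ
    have hvy : v ≠ y := by rintro rfl; exact h.hy hvQ
    exact hxy.ne (h.eq_of_adj hGb hGd hQ hvQ h.hx h.hy (hR.1 hxR hvR hvx.symm)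
      (hR.1 hyR hvR hvy.symm))
  have hdisj' : ∀ v ∈ R, v ∉ Q := fun v h1 h2 => hdisj v h2 h1
  have h' : ThreeAttachments G R x y z a b c :=
    ⟨hxR, hyR, hzR, hxy.ne, hxz.ne, hyz.ne, hdisj a h.memA, hdisj b h.memB, hdisj c h.memC,
      h.hxa.symm, h.hyb.symm, h.hzc.symm⟩
  have hcover : ∀ v, v ∈ Q ∨ v ∈ R := by
    intro v
    by_contra hv
    obtain ⟨p⟩ := hconn.preconnected a v
    obtain ⟨d, -, hd1, hd2⟩ := p.exists_boundary_dart (Q ∪ R) (Or.inl h.memA) hv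
    have hadj := d.adj.symm
    rw [Set.mem_union, not_or] at hd2
    rcases hd1 with hd1 | hd1
    · exact hd2.2 (h.mem_of_adj hGb hGd hQ hR hxR hyR hzR hd1 hd2.1 hadj)
    · exact hd2.1 (h'.mem_of_adj hGb hGd hR hQ h.memA h.memB h.memC hd1 hd2.2 hadj)
  have hcardQ : Q.toFinset.card ≤ Fintype.card (Fin G.cliqueNum) := by
    rw [Fintype.card_fin]
    exact SimpleGraph.IsClique.card_le_cliqueNum (tc := by simpa using hQ.1)
  have hcardR : R.toFinset.card ≤ Fintype.card (Fin G.cliqueNum) := by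
    rw [Fintype.card_fin]
    exact SimpleGraph.IsClique.card_le_cliqueNum (tc := by simpa using hR.1)
  have hne : Nonempty (Fin G.cliqueNum) := by
    rw [← Fintype.card_pos_iff]
    exact (Finset.card_pos.2 ⟨a, by simpa using h.memA⟩).trans_le hcardQ
  obtain ⟨σ, hσ, -⟩ := Set.InjOn.exists_injOn_extend (f := fun _ : V => hne.some) (S := ∅)
    (Q := Q.toFinset) (by simp) (by simp) hcardQ
  rw [Set.coe_toFinset] at hσ
  let S : Finset V := R.toFinset.filter fun v => ∃ q ∈ Q, G.Adj v q
  let m : V → V := fun v => if hv : ∃ q ∈ Q, G.Adj v q then hv.choose else v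
  have hm : ∀ v q, v ∈ R → q ∈ Q → G.Adj v q → m v = q := by
    intro v q hvR hq hvq
    have hv : ∃ q ∈ Q, G.Adj v q := ⟨q, hq, hvq⟩
    simp only [m, dif_pos hv]
    exact hGd.eq_of_adj_maximal_clique hQ (hdisj' v hvR) hv.choose_spec.1 hq
      hv.choose_spec.2 hvq
  obtain ⟨τ, hτ, hτS⟩ := Set.InjOn.exists_injOn_extend (f := fun v => σ (m v)) (S := S)
    (Q := R.toFinset) (by
      intro u hu v hv huv
      simp only [S, Finset.coe_filter, Set.mem_ofPred_eq, Set.mem_toFinset] at hu hv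
      obtain ⟨huR, q, hq, huq⟩ := hu
      obtain ⟨hvR, r, hr, hvr⟩ := hv
      simp only [hm u q huR hq huq, hm v r hvR hr hvr] at huv
      obtain rfl := hσ hq hr huv
      exact h.eq_of_adj hGb hGd hQ hq (hdisj' u huR) (hdisj' v hvR) huq hvr)
    (Finset.filter_subset _ _) hcardR
  rw [Set.coe_toFinset] at hτ
  have hcross : ∀ v q, v ∈ R → q ∈ Q → G.Adj v q → τ v = σ q := by
    intro v q hvR hq hvq
    have hvS : v ∈ S := by
      simp only [S, Finset.mem_filter, Set.mem_toFinset]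
      exact ⟨hvR, q, hq, hvq⟩
    rw [hτS hvS]
    simp only [hm v q hvR hq hvq]
  refine ⟨⟨fun v => if v ∈ Q then (σ v, 0) else (τ v, 1), ?_⟩, ?_⟩
  · intro u v huv
    rw [SimpleGraph.boxProd_adj]
    by_cases hu : u ∈ Q <;> by_cases hv : v ∈ Q <;>
      simp only [hu, hv, if_true, if_false, SimpleGraph.completeGraph_eq_top,
        SimpleGraph.top_adj]
    · exact Or.inl ⟨fun e => huv.ne (hσ hu hv e), trivial⟩
    · exact Or.inr ⟨by simp, (hcross v u ((hcover v).resolve_left hv) hu huv.symm).symm⟩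
    · exact Or.inr ⟨by simp, hcross u v ((hcover u).resolve_left hu) hv huv⟩
    · exact Or.inl ⟨fun e => huv.ne (hτ ((hcover u).resolve_left hu)
        ((hcover v).resolve_left hv) e), trivial⟩
  · intro u v huv
    change (if u ∈ Q then (σ u, (0 : Fin 2)) else (τ u, 1)) =
      (if v ∈ Q then (σ v, 0) else (τ v, 1)) at huv
    by_cases hu : u ∈ Q <;> by_cases hv : v ∈ Q <;>
      simp only [hu, hv, if_true, if_false, Prod.mk.injEq] at huv
    · exact hσ hu hv huv.1
    · simp at huv
    · simp at huv
    · exact hτ ((hcover u).resolve_left hu) ((hcover v).resolve_left hv) huv.1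

end ThreeAttachments

end Cliques

section Levels

variable {V : Type*} {G : SimpleGraph V} {K : Set V}

theorem distToSet_le {k : V} (hk : k ∈ K) (v : V) : distToSet G v K ≤ G.dist v k :=
  Nat.sInf_le ⟨k, hk, rfl⟩

theorem exists_dist_eq_distToSet (hK : K.Nonempty) (v : V) :
    ∃ k ∈ K, G.dist v k = distToSet G v K :=
  Nat.sInf_mem (hK.image _)

theorem distToSet_eq_zero_iff (hG : G.Connected) (hK : K.Nonempty) {v : V} :
    distToSet G v K = 0 ↔ v ∈ K := by
  constructor
  · intro h
    obtain ⟨k, hk, hvk⟩ := exists_dist_eq_distToSet (G := G) hK v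
    rw [h, hG.dist_eq_zero_iff] at hvk
    exact hvk ▸ hk
  · intro h
    have := distToSet_le (G := G) h v
    simpa using this

theorem distToSet_le_of_adj (hG : G.Connected) (hK : K.Nonempty) {u v : V} (h : G.Adj u v) :
    distToSet G u K ≤ distToSet G v K + 1 := by
  obtain ⟨k, hk, hvk⟩ := exists_dist_eq_distToSet (G := G) hK v
  have h1 := distToSet_le (G := G) hk u
  have h2 := hG.dist_triangle (u := u) (v := v) (w := k)
  rw [SimpleGraph.dist_eq_one_iff_adj.2 h] at h2
  omega

theorem exists_adj_distToSet (hG : G.Connected) (hK : K.Nonempty) {v : V} {n : ℕ}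
    (h : distToSet G v K = n + 1) : ∃ u, G.Adj v u ∧ distToSet G u K = n := by
  obtain ⟨k, hk, hvk⟩ := exists_dist_eq_distToSet (G := G) hK v
  obtain ⟨p, hp⟩ := hG.exists_walk_length_eq_dist v k
  cases p with
  | nil => rw [SimpleGraph.dist_self] at hvk; omega
  | cons hadj q =>
    rename_i u
    refine ⟨u, hadj, ?_⟩
    have h1 := distToSet_le (G := G) hk u
    have h2 := SimpleGraph.dist_le q
    have h3 := distToSet_le_of_adj hG hK hadj
    simp only [SimpleGraph.Walk.length_cons] at hp
    omega

theorem mem_union_levelSet_iff (hG : G.Connected) (hK : K.Nonempty) {i : ℕ} (hi : 1 ≤ i)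
    {v : V} : v ∈ K ∪ ⋃ j ∈ Set.Icc 1 (i - 1), levelSet G K j ↔ distToSet G v K < i := by
  simp only [Set.mem_union, Set.mem_iUnion, levelSet, Set.mem_ofPred_eq, Set.mem_Icc,
    ← distToSet_eq_zero_iff hG hK]
  constructor
  · rintro (h | ⟨j, hj, h⟩) <;> omega
  · intro h
    by_cases h0 : distToSet G v K = 0
    · exact Or.inl h0
    · exact Or.inr ⟨_, ⟨by omega, by omega⟩, rfl⟩

end Levels

theorem statement_17 {V : Type*} [Fintype V] [DecidableEq V] (G : SimpleGraph V)
    (hconn : G.Connected) (hGb : IsIndFree G bull) (hGd : IsIndFree G diamond)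
    (hw : 2 < G.cliqueNum) (K : Finset V) (hK : G.IsMaximumClique K)
    (hsub : ¬ ∃ f : G →g (completeGraph (Fin G.cliqueNum) □ completeGraph (Fin 2)),
      Function.Injective f)
    (i : ℕ) (hi : 2 ≤ i)
    (c : (G.induce (levelSet G (↑K) i)).ConnectedComponent)
    (C : Set V)
    (hC : C = {x | ∃ h : x ∈ levelSet G (↑K) i,
      (G.induce (levelSet G (↑K) i)).connectedComponentMk ⟨x, h⟩ = c})
    (htri : ∃ x ∈ C, ∃ y ∈ C, ∃ z ∈ C, G.Adj x y ∧ G.Adj y z ∧ G.Adj x z)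
    (k : ℕ) (hk : 0 < k)
    (hcol : (G.induce ((↑K : Set V) ∪ ⋃ j ∈ Set.Icc 1 (i - 1), levelSet G (↑K) j)).Colorable k) :
    (G.induce (((↑K : Set V) ∪ ⋃ j ∈ Set.Icc 1 (i - 1), levelSet G (↑K) j) ∪ C)).Colorable k := by
  classical
  have hKcard : K.card = G.cliqueNum := G.maximumClique_card_eq_cliqueNum K hK
  have hKne : (K : Set V).Nonempty := Finset.coe_nonempty.2 (Finset.card_pos.1 (by omega))
  have hmem {v : V} := mem_union_levelSet_iff hconn hKne (i := i) (v := v) (by omega)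
  have hlip {u v : V} (h : G.Adj u v) := distToSet_le_of_adj hconn hKne h
  obtain ⟨col⟩ := hcol
  have hdC : ∀ v ∈ C, distToSet G v K = i := fun v hv => by
    rw [hC] at hv
    exact hv.1
  obtain ⟨t₁, ht₁, t₂, ht₂, t₃, ht₃, h12, h23, h13⟩ := htri
  obtain ⟨Q, htQ, hQ⟩ := Finite.exists_le_maximal (p := G.IsClique) (a := {t₁, t₂, t₃}) (by
    intro u hu v hv huv
    simp only [Set.mem_insert_iff, Set.mem_singleton_iff] at hu hv
    rcases hu with rfl | rfl | rfl <;> rcases hv with rfl | rfl | rfl <;>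
      simp_all [SimpleGraph.adj_comm])
  have htQ₁ : t₁ ∈ Q := htQ (by simp)
  have htQ₂ : t₂ ∈ Q := htQ (by simp)
  have htQ₃ : t₃ ∈ Q := htQ (by simp)
  have hQ3 : ∀ p q, ∃ r ∈ Q, r ≠ p ∧ r ≠ q := by
    intro p q
    have := h12.ne; have := h13.ne; have := h23.ne
    by_cases h₁ : t₁ = p ∨ t₁ = q
    · by_cases h₂ : t₂ = p ∨ t₂ = q
      · exact ⟨t₃, by grind⟩
      · exact ⟨t₂, by grind⟩
    · exact ⟨t₁, by grind⟩
  have hnot3 : ∀ {a b c x y z : V}, ¬ ThreeAttachments G Q a b c x y z := fun h =>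
    hsub (h.exists_hom hconn hGb hGd hQ)
  have hlow : ∀ q ∈ Q, i ≤ distToSet G q K + 1 := by
    intro q hq
    by_cases h : t₁ = q
    · rw [← h, hdC t₁ ht₁]; omega
    · rw [← hdC t₁ ht₁]
      exact hlip (hQ.1 htQ₁ hq h)
  -- the clique `Q` reaches down to the previous level
  obtain ⟨p, hpQ, hpd⟩ : ∃ p ∈ Q, distToSet G p K < i := by
    by_contra! hall
    have hpred : ∀ v ∈ C, ∃ u ∉ Q, G.Adj u v := fun v hv => by
      obtain ⟨u, hu, hud⟩ := exists_adj_distToSet (n := i - 1) hconn hKne (v := v)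
        (by rw [hdC v hv]; omega)
      exact ⟨u, fun huQ => by have := hall u huQ; omega, hu.symm⟩
    obtain ⟨x, hx, hxa⟩ := hpred t₁ ht₁
    obtain ⟨y, hy, hyb⟩ := hpred t₂ ht₂
    obtain ⟨z, hz, hzc⟩ := hpred t₃ ht₃
    exact hnot3 ⟨htQ₁, htQ₂, htQ₃, h12.ne, h13.ne, h23.ne, hx, hy, hz, hxa, hyb, hzc⟩
  have hpred : ∀ q ∈ Q, distToSet G q K < i →
      ∃ u ∉ Q, G.Adj u q ∧ distToSet G u K + 2 = i := fun q hq hqd => by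
    have := hlow q hq
    obtain ⟨u, hu, hud⟩ := exists_adj_distToSet (n := i - 2) hconn hKne (v := q) (by omega)
    exact ⟨u, fun huQ => by have := hlow u huQ; omega, hu.symm, by omega⟩
  obtain ⟨p', hp'Q, hp'p, hp'd⟩ := hpred p hpQ hpd
  have hout : ∀ v ∈ Q, distToSet G v K = i → ∀ w ∉ Q, G.Adj w v →
      distToSet G w K < i ∧ G.Adj w p' := by
    intro v hv hvd w hw hwv
    have hvp : v ≠ p := by rintro rfl; omega
    have h := adj_of_adj_maximal_clique hGb hGd hQ hQ3 hv hpQ hvp hw hp'Q hwv hp'p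
    have := hlip h
    exact ⟨by omega, h⟩
  have hCQ : ∀ v ∈ C, v ∈ Q := by
    intro v hv
    by_contra hvQ
    rw [hC] at hv ht₁
    obtain ⟨h₁, hc₁⟩ := ht₁
    obtain ⟨hv', hcv⟩ := hv
    obtain ⟨w⟩ := SimpleGraph.ConnectedComponent.exact (hc₁.trans hcv.symm)
    obtain ⟨e, -, he1, he2⟩ := w.exists_boundary_dart {u | (u : V) ∈ Q} htQ₁ hvQ
    have := (hout e.fst he1 e.fst.2 e.snd he2 e.adj.symm).1
    have : distToSet G (e.snd : V) K = i := e.snd.2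
    omega
  let f : V → Fin k := fun v =>
    if h : distToSet G v K < i then col ⟨v, hmem.2 h⟩ else col ⟨p', hmem.2 (by omega)⟩
  have hf : ∀ {u v}, distToSet G u K < i → distToSet G v K < i → G.Adj u v → f u ≠ f v := by
    intro u v hu hv huv
    simp only [f, dif_pos hu, dif_pos hv]
    exact col.valid huv
  have hfi : ∀ {v}, distToSet G v K = i → f v = f p' := by
    intro v hv
    simp only [f, dif_pos (show distToSet G p' K < i by omega), hv, lt_irrefl, dif_neg,
      not_false_eq_true]
  have hcardK : K.card ≤ k := by
    have hK0 : ∀ v ∈ K, distToSet G v K < i := fun v hv => by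
      rw [(distToSet_eq_zero_iff hconn hKne).2 hv]
      omega
    have := Finset.card_le_card_of_injOn (s := K) (t := Finset.univ) f (by simp) (by
      intro u hu v hv huv
      by_contra hne
      exact hf (hK0 u hu) (hK0 v hv) (hK.isClique hu hv hne) huv)
    simpa using this
  have hcardQ : Q.toFinset.card ≤ Fintype.card (Fin k) := by
    have := SimpleGraph.IsClique.card_le_cliqueNum (G := G) (t := Q.toFinset)
      (tc := by simpa using hQ.1)
    rw [Fintype.card_fin]
    omega
  let S : Finset V := Q.toFinset.filter fun q =>
    distToSet G q K < i ∨ distToSet G q K = i ∧ ∃ w ∉ Q, G.Adj w q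
  have hS : ∀ {q}, q ∈ S ↔
      q ∈ Q ∧ (distToSet G q K < i ∨ distToSet G q K = i ∧ ∃ w ∉ Q, G.Adj w q) := by
    simp [S]
  have hmixed : ∀ {u v}, u ∈ Q → v ∈ Q → distToSet G u K < i → distToSet G v K = i →
      (∃ w ∉ Q, G.Adj w v) → f u ≠ f v := by
    rintro u v hu hv hud hvd ⟨w, hw, hwv⟩
    have hup : u = p := by
      by_contra hup
      obtain ⟨u', hu', hu'u, -⟩ := hpred u hu hud
      refine hnot3 ⟨hu, hpQ, hv, hup, ?_, ?_, hu', hp'Q, hw, hu'u, hp'p, hwv⟩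
      · rintro rfl; omega
      · rintro rfl; omega
    rw [hfi hvd, hup]
    exact hf hpd (by omega) hp'p.symm
  have hfS : Set.InjOn f S := by
    intro u hu v hv huv
    by_contra hne
    obtain ⟨huQ, hu⟩ := hS.1 hu
    obtain ⟨hvQ, hv⟩ := hS.1 hv
    rcases hu with hu | ⟨hu, hu'⟩ <;> rcases hv with hv | ⟨hv, hv'⟩
    · exact hf hu hv (hQ.1 huQ hvQ hne) huv
    · exact hmixed huQ hvQ hu hv hv' huv
    · exact hmixed hvQ huQ hv hu hu' huv.symm
    · obtain ⟨x, hx, hxu⟩ := hu'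
      obtain ⟨y, hy, hyv⟩ := hv'
      refine hnot3 ⟨huQ, hvQ, hpQ, hne, ?_, ?_, hx, hy, hp'Q, hxu, hyv, hp'p⟩
      · rintro rfl; omega
      · rintro rfl; omega
  obtain ⟨g, hg, hgf⟩ := hfS.exists_injOn_extend (Finset.filter_subset _ _) hcardQ
  rw [Set.coe_toFinset] at hg
  have hgf' : ∀ {u v}, u ∈ C → distToSet G v K < i → G.Adj u v → g u ≠ f v := by
    intro u v hu hv huv
    have huQ := hCQ u hu
    have hud := hdC u hu
    by_cases hvQ : v ∈ Q
    · rw [← hgf (hS.2 ⟨hvQ, Or.inl hv⟩)]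
      exact fun e => huv.ne (hg huQ hvQ e)
    · rw [hgf (hS.2 ⟨huQ, Or.inr ⟨hud, v, hvQ, huv.symm⟩⟩), hfi hud]
      exact hf (by omega) hv (hout u huQ hud v hvQ huv.symm).2.symm
  have hCi : ∀ {v}, v ∈ C → ¬ distToSet G v K < i := fun hv => by
    rw [hdC _ hv]
    exact lt_irrefl i
  refine ⟨SimpleGraph.Coloring.mk (fun v => if (v : V) ∈ C then g v else f v) ?_⟩
  rintro ⟨u, hu⟩ ⟨v, hv⟩ huv
  have huv : G.Adj u v := huv
  rw [Set.mem_union, hmem] at hu hv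
  change (if u ∈ C then g u else f u) ≠ (if v ∈ C then g v else f v)
  by_cases huC : u ∈ C <;> by_cases hvC : v ∈ C <;> simp only [huC, hvC, if_true, if_false]
  · exact fun e => huv.ne (hg (hCQ u huC) (hCQ v hvC) e)
  · exact hgf' huC (hv.resolve_right hvC) huv
  · exact (hgf' hvC (hu.resolve_right huC) huv.symm).symm
  · exact hf (hu.resolve_right huC) (hv.resolve_right hvC) huv
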